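/- arXiv:1807.05794 — 11 statements merged into one kernel-verified Lean document; each statement's English description precedes it below -/
import Mathlib

section
/- Let R be a commutative ring and let a, b, c ∈ R. There exists a unique formal power series A ∈ R[[X]] with constant coefficient 1 satisfying the quadratic equation A² = (1 + aX − bX²)·A + bX² − cX³. (This A is the generating function of the A-sequence of the Bell pseudo-involution whose B-sequence has generating function B(x) = (a − cx)/(1 + bx); the quadratic is the polynomial form of the functional equation A(x) = 1 + x·B(x²/A(x)).) -/
open PowerSeries

/-- For a commutative ring `R` and `a b c : R`, there is a unique formal power series `A`
with constant coefficient `1` satisfying `A² = (1 + aX − bX²)·A + bX² − cX³`. -/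
theorem stmt_0 (R : Type*) [CommRing R] (a b c : R) :
    ∃! A : PowerSeries R, constantCoeff A = 1 ∧
      A ^ 2 = (1 + C a * X - C b * X ^ 2) * A + C b * X ^ 2 - C c * X ^ 3 := by
  obtain ⟨P, hP⟩ : ∃ P : PowerSeries R, P = 1 + C a * X - C b * X ^ 2 := ⟨_, rfl⟩
  obtain ⟨Q, hQ⟩ : ∃ Q : PowerSeries R, Q = C b * X ^ 2 - C c * X ^ 3 := ⟨_, rfl⟩
  have hP0 : constantCoeff P = 1 := by simp [hP]
  have hQ0 : constantCoeff Q = 0 := by simp [hQ]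
  have key : ∀ A : PowerSeries R,
      (A ^ 2 = (1 + C a * X - C b * X ^ 2) * A + C b * X ^ 2 - C c * X ^ 3) ↔
        A ^ 2 = P * A + Q := by
    intro A
    rw [hP, hQ, add_sub_assoc]
  simp only [key]
  apply existsUnique_of_exists_of_unique
  · have hm : (Polynomial.X ^ 2 - (Polynomial.C P * Polynomial.X + Polynomial.C Q) :
        Polynomial (PowerSeries R)).Monic := by
      apply Polynomial.monic_X_pow_sub
      exact lt_of_le_of_lt Polynomial.degree_linear_le (by norm_num)
    obtain ⟨A, hA, hA1⟩ := HenselianRing.is_henselian (I := Ideal.span {(X : PowerSeries R)})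
      _ hm 1 (by
        rw [Ideal.mem_span_singleton, X_dvd_iff]
        simp [hP0, hQ0]) (by
        apply IsUnit.map
        rw [PowerSeries.isUnit_iff_constantCoeff]
        simp [hP0]; try norm_num)
    rw [Ideal.mem_span_singleton, X_dvd_iff] at hA1
    refine ⟨A, ?_, ?_⟩
    · simpa [sub_eq_zero] using hA1
    · simpa [sub_eq_zero] using hA
  · rintro A B ⟨hA, hA'⟩ ⟨hB, hB'⟩
    have hu : IsUnit (A + B - P) := by
      rw [PowerSeries.isUnit_iff_constantCoeff]
      simp [hA, hB, hP0]
    have : (A + B - P) * (A - B) = 0 := by linear_combination hA' - hB'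
    exact sub_eq_zero.1 (hu.mul_right_eq_zero.1 this)
end

section
/- Let a, b, c ∈ ℚ, and let A ∈ ℚ[[X]] be the unique power series with constant coefficient 1 satisfying A² = (1 + aX − bX²)·A + bX² − cX³. Let C(X) = Σ_{n≥0} Catalan(n)·Xⁿ be the generating function of the Catalan numbers, and let h be the power series obtained by substituting the series (ab+c)·X³·(1 + aX + bX²)⁻² (which has constant coefficient 0) into C(X), multiplied by (1 + aX + bX²)⁻¹. Then A = 1 + aX − (ab+c)·X³·h. (This is the identity A(x) = 1 + ax − (x³(ab+c)/(1+ax+bx²))·c(x³(ab+c)/(1+ax+bx²)²) where c is the Catalan generating function.) -/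
open PowerSeries

/-- Substitution of the power series `f` (intended: with zero constant coefficient) into the
power series `g`: the `n`-th coefficient of `g(f)` is `∑_{k=0}^{n} gₖ · [Xⁿ] fᵏ`. -/
noncomputable def substSeries (f g : PowerSeries ℚ) : PowerSeries ℚ :=
  PowerSeries.mk fun n => ∑ k ∈ Finset.range (n + 1), coeff k g * coeff n (f ^ k)

/-- The generating function of the Catalan numbers, `C(X) = ∑_{n≥0} Catalan(n)·Xⁿ`. -/
noncomputable def catalanSeries : PowerSeries ℚ :=
  PowerSeries.mk fun n => (catalan n : ℚ)

theorem substSeries_eq_subst (f g : PowerSeries ℚ) (hf : constantCoeff f = 0) :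
    substSeries f g = g.subst f := by
  have hs : HasSubst f := HasSubst.of_constantCoeff_zero' hf
  ext n
  rw [coeff_subst' hs, substSeries, coeff_mk]
  rw [finsum_eq_sum_of_support_subset (s := Finset.range (n + 1))]
  · simp [smul_eq_mul]
  · intro k hk
    rw [Function.mem_support] at hk
    by_contra hkn
    apply hk
    have h1 : n < k := by simpa using hkn
    have h2 : coeff n (f ^ k) = 0 := by
      apply coeff_of_lt_order
      refine lt_of_lt_of_le ?_ (le_order_pow_of_constantCoeff_eq_zero k hf)
      exact_mod_cast h1
    rw [h2, smul_zero]

theorem catalanSeries_rat_eq :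
    (_root_.catalanSeries) = 1 + X * (_root_.catalanSeries) ^ 2 := by
  have h := congrArg (PowerSeries.map (Nat.castRingHom ℚ))
    PowerSeries.catalanSeries_sq_mul_X_add_one
  have e : PowerSeries.map (Nat.castRingHom ℚ) PowerSeries.catalanSeries
      = _root_.catalanSeries := by
    ext n
    simp [_root_.catalanSeries]
  simp only [map_add, map_mul, map_pow, map_one, PowerSeries.map_X, e] at h
  linear_combination -h

theorem substSeries_catalan (f : PowerSeries ℚ) (hf : constantCoeff f = 0) :
    substSeries f _root_.catalanSeries
      = 1 + f * (substSeries f _root_.catalanSeries) ^ 2 := by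
  have hs : HasSubst f := HasSubst.of_constantCoeff_zero' hf
  rw [substSeries_eq_subst f _ hf]
  have h := congrArg (substAlgHom (R := ℚ) hs) catalanSeries_rat_eq
  simp only [map_add, map_mul, map_pow, map_one, substAlgHom_X] at h
  rwa [coe_substAlgHom] at h

/-- If `A` is the power series with constant coefficient `1` satisfying
`A² = (1 + aX − bX²)·A + bX² − cX³`, then
`A = 1 + aX − (ab+c)X³ · (1 + aX + bX²)⁻¹ · c((ab+c)X³(1 + aX + bX²)⁻²)`,
where `c` is the Catalan generating function. -/
theorem stmt_2 (a b c : ℚ) (A : PowerSeries ℚ)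
    (hA0 : constantCoeff A = 1)
    (hA : A ^ 2 = (1 + C a * X - C b * X ^ 2) * A + C b * X ^ 2 - C c * X ^ 3) :
    A = 1 + C a * X - C (a * b + c) * X ^ 3 *
      ((1 + C a * X + C b * X ^ 2)⁻¹ *
        substSeries (C (a * b + c) * X ^ 3 * ((1 + C a * X + C b * X ^ 2)⁻¹) ^ 2)
          catalanSeries) := by
  have hD : (1 + C a * X + C b * X ^ 2 : PowerSeries ℚ) * (1 + C a * X + C b * X ^ 2)⁻¹ = 1 := by
    apply PowerSeries.mul_inv_cancel
    simp
  have hS := substSeries_catalan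
    (C (a * b + c) * X ^ 3 * ((1 + C a * X + C b * X ^ 2)⁻¹) ^ 2) (by simp)
  generalize substSeries (C (a * b + c) * X ^ 3 * ((1 + C a * X + C b * X ^ 2)⁻¹) ^ 2)
    _root_.catalanSeries = S at hS ⊢
  generalize (1 + C a * X + C b * X ^ 2 : PowerSeries ℚ)⁻¹ = I at hD hS ⊢
  have ht : (C (a * b + c) * X ^ 3 * (I * S)) ^ 2
      = (1 + C a * X + C b * X ^ 2) * (C (a * b + c) * X ^ 3 * (I * S))
        - C (a * b + c) * X ^ 3 := by
    linear_combination (-C (a * b + c) * X ^ 3) * hS - C (a * b + c) * X ^ 3 * S * hD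
  have h0 : constantCoeff (C (a * b + c) * X ^ 3 * (I * S)) = 0 := by simp
  generalize C (a * b + c) * X ^ 3 * (I * S) = t at ht h0 ⊢
  rw [map_add, map_mul] at ht
  have key : (A - (1 + C a * X - t)) * (A - t + C b * X ^ 2) = 0 := by
    linear_combination hA - ht
  rcases mul_eq_zero.mp key with h | h
  · exact sub_eq_zero.mp h
  · have := congrArg constantCoeff h
    simp [hA0, h0] at this
end

section
/- Let R be a commutative ring and let a, b, c ∈ R. There exists a unique formal power series g ∈ R[[X]] with constant coefficient 1 satisfying X²(b + cX)·g² + (1 − aX − bX²)·g = 1. (This g is the defining generating function of the Bell pseudo-involution (g(x), xg(x)) whose B-sequence has generating function B(x) = (a − cx)/(1 + bx), and the equation is the polynomial form of the periodic continued fraction g = 1/(1 − ax − bx² + x²(b+cx)·g).) -/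
open PowerSeries

lemma aux_zero {R : Type*} [CommRing R] (f : PowerSeries R) (h : ∀ n : ℕ, X ^ n ∣ f) : f = 0 := by
  ext n
  have := (X_pow_dvd_iff.1 (h (n+1))) n (Nat.lt_succ_self n)
  simpa using this

lemma aux_fix {R : Type*} [CommRing R] (F : PowerSeries R → PowerSeries R)
    (hF : ∀ f g, X * (f - g) ∣ F f - F g) : ∃! g, F g = g := by
  have step : ∀ (n : ℕ) f g, X ^ n ∣ f - g → X ^ (n+1) ∣ F f - F g := by
    intro n f g h
    refine dvd_trans ?_ (hF f g)
    rw [pow_succ']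
    exact mul_dvd_mul_left _ h
  let s : ℕ → PowerSeries R := fun n => F^[n] 1
  have hs : ∀ n, s (n+1) = F (s n) := fun n => Function.iterate_succ_apply' F n 1
  have h1 : ∀ n, X ^ n ∣ s (n+1) - s n := by
    intro n
    induction n with
    | zero => simp
    | succ k ih => rw [hs (k+1), hs k]; rw [hs k] at ih; exact step _ _ _ ih
  have h2 : ∀ n k, X ^ n ∣ s (n+k) - s n := by
    intro n k
    induction k with
    | zero => simp
    | succ k ih =>
      have := dvd_add (dvd_trans (pow_dvd_pow X (Nat.le_add_right n k)) (h1 (n+k))) ih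
      simpa [add_assoc] using this
  let g : PowerSeries R := mk fun n => coeff n (s (n+1))
  have hg : ∀ n, X ^ n ∣ g - s n := by
    intro n
    rw [X_pow_dvd_iff]
    intro m hm
    obtain ⟨k, rfl⟩ := Nat.exists_eq_add_of_le (Nat.succ_le_of_lt hm)
    have := X_pow_dvd_iff.1 (h2 (m+1) k) m (Nat.lt_succ_self m)
    rw [map_sub, sub_eq_zero] at this ⊢
    simp only [g, coeff_mk]
    exact this.symm
  refine ⟨g, ?_, ?_⟩
  · refine sub_eq_zero.1 (aux_zero _ fun n => ?_)
    have e : F g - g = (F g - F (s n)) - (g - s (n+1)) := by rw [hs]; ring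
    rw [e]
    exact dvd_trans (pow_dvd_pow X (Nat.le_succ n)) (dvd_sub (step _ _ _ (hg n)) (hg (n+1)))
  · intro y hy
    refine sub_eq_zero.1 (aux_zero _ fun n => ?_)
    have hgg : F g = g := by
      refine sub_eq_zero.1 (aux_zero _ fun n => ?_)
      have e : F g - g = (F g - F (s n)) - (g - s (n+1)) := by rw [hs]; ring
      rw [e]
      exact dvd_trans (pow_dvd_pow X (Nat.le_succ n)) (dvd_sub (step _ _ _ (hg n)) (hg (n+1)))
    induction n with
    | zero => simp
    | succ k ih =>
      have := step _ _ _ ih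
      rwa [hy, hgg] at this

/-- For a commutative ring `R` and `a b c : R`, there is a unique formal power series `g`
with constant coefficient `1` satisfying `X²(b + cX)·g² + (1 − aX − bX²)·g = 1`. -/
theorem stmt_3 (R : Type*) [CommRing R] (a b c : R) :
    ∃! g : PowerSeries R, constantCoeff g = 1 ∧
      X ^ 2 * (C b + C c * X) * g ^ 2 + (1 - C a * X - C b * X ^ 2) * g = 1 := by
  obtain ⟨g, hg, hu⟩ := aux_fix (R := R)
    (fun g => 1 + X * (C a * g + C b * X * g - X * (C b + C c * X) * g ^ 2)) (by
      intro f g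
      exact ⟨C a + C b * X - X * (C b + C c * X) * (f + g), by ring⟩)
  refine ⟨g, ⟨?_, ?_⟩, ?_⟩
  · have := congrArg constantCoeff hg
    simpa using this.symm
  · linear_combination -hg
  · rintro y ⟨-, hy⟩
    apply hu
    linear_combination -hy
end

section
/- Let a, b, c ∈ ℚ, and let g ∈ ℚ[[X]] be the unique power series with constant coefficient 1 satisfying X²(b + cX)·g² + (1 − aX − bX²)·g = 1. Let C(X) = Σ_{n≥0} Catalan(n)·Xⁿ be the generating function of the Catalan numbers. Then g equals (1 − aX − bX²)⁻¹ times the power series obtained by substituting −X²(b + cX)·(1 − aX − bX²)⁻² (which has constant coefficient 0) into C(X). (This is the identity g(x) = (1/(1 − ax − bx²))·c(−x²(b + cx)/(1 − ax − bx²)²).) -/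
open PowerSeries

theorem catalanSeries_eqn :
    (_root_.catalanSeries) = 1 + X * _root_.catalanSeries ^ 2 := by
  have h := congrArg (PowerSeries.map (Nat.castRingHom ℚ))
    PowerSeries.catalanSeries_sq_mul_X_add_one
  have e : PowerSeries.map (Nat.castRingHom ℚ) PowerSeries.catalanSeries
      = _root_.catalanSeries := by
    ext n
    simp [_root_.catalanSeries]
  simp only [map_add, map_mul, map_pow, map_one, PowerSeries.map_X, e] at h
  linear_combination -h

theorem substSeries_eqn (f : PowerSeries ℚ) (hf : constantCoeff f = 0) :
    substSeries f _root_.catalanSeries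
      = 1 + f * substSeries f _root_.catalanSeries ^ 2 := by
  rw [substSeries_eq_subst _ _ hf]
  have hs := HasSubst.of_constantCoeff_zero' hf
  have h := congrArg (substAlgHom (R := ℚ) hs) catalanSeries_eqn
  simp only [map_add, map_mul, map_pow, map_one, substAlgHom_X] at h
  simpa only [coe_substAlgHom] using h

/-- If `g` is the power series with constant coefficient `1` satisfying
`X²(b + cX)·g² + (1 − aX − bX²)·g = 1`, then
`g = (1 − aX − bX²)⁻¹ · c(−X²(b + cX)·(1 − aX − bX²)⁻²)`,
where `c` is the Catalan generating function. -/
theorem stmt_5 (a b c : ℚ) (g : PowerSeries ℚ)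
    (hg0 : constantCoeff g = 1)
    (hg : X ^ 2 * (C b + C c * X) * g ^ 2 + (1 - C a * X - C b * X ^ 2) * g = 1) :
    g = (1 - C a * X - C b * X ^ 2)⁻¹ *
      substSeries (-(X ^ 2 * (C b + C c * X)) * ((1 - C a * X - C b * X ^ 2)⁻¹) ^ 2)
        catalanSeries := by
  have hD : (1 - C a * X - C b * X ^ 2 : PowerSeries ℚ) *
      (1 - C a * X - C b * X ^ 2)⁻¹ = 1 := PowerSeries.mul_inv_cancel _ (by simp)
  have hS := substSeries_eqn
    (-(X ^ 2 * (C b + C c * X)) * ((1 - C a * X - C b * X ^ 2)⁻¹) ^ 2) (by simp)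
  generalize substSeries
    (-(X ^ 2 * (C b + C c * X)) * ((1 - C a * X - C b * X ^ 2)⁻¹) ^ 2) _ = S at hS ⊢
  generalize (1 - C a * X - C b * X ^ 2 : PowerSeries ℚ)⁻¹ = u at hD hS ⊢
  have hz : (g - u * S) * (X ^ 2 * (C b + C c * X) * (g + u * S)
      + (1 - C a * X - C b * X ^ 2)) = 0 := by
    linear_combination hg - hS - S * hD
  rcases mul_eq_zero.mp hz with h | h
  · exact sub_eq_zero.mp h
  · have := congrArg constantCoeff h
    simp at this
end

section
/- Let R be a commutative ring and a, b, c ∈ R. Let A ∈ R[[X]] be the unique power series with constant coefficient 1 satisfying A² = (1 + aX − bX²)·A + bX² − cX³, and let g ∈ R[[X]] be the unique power series with constant coefficient 1 satisfying X²(b + cX)·g² + (1 − aX − bX²)·g = 1. Then A(−X)·g(X) = 1, where A(−X) denotes the series obtained from A by replacing X with −X (rescaling by −1). (This is the relation g(x) = 1/A(−x) between the defining series of a Bell pseudo-involution and its A-sequence generating function.) -/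
open PowerSeries

/-- If `A` is the unique power series with constant coefficient `1` satisfying
`A² = (1 + aX − bX²)·A + bX² − cX³`, and `g` is the unique power series with constant
coefficient `1` satisfying `X²(b + cX)·g² + (1 − aX − bX²)·g = 1`, then `A(−X)·g(X) = 1`. -/
theorem stmt_6 {R : Type*} [CommRing R] (a b c : R) (A g : PowerSeries R)
    (hA0 : constantCoeff A = 1)
    (hA : A ^ 2 = (1 + C a * X - C b * X ^ 2) * A + C b * X ^ 2 - C c * X ^ 3)
    (hg0 : constantCoeff g = 1)
    (hg : X ^ 2 * (C b + C c * X) * g ^ 2 + (1 - C a * X - C b * X ^ 2) * g = 1) :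
    rescale (-1) A * g = 1 := by
  have hX : rescale (-1 : R) X = -X := by
    rw [rescale_X]; simp
  have hC : ∀ r : R, rescale (-1 : R) (C r) = C r := by
    intro r
    ext n
    rw [coeff_rescale, coeff_C]
    split_ifs with h
    · simp [h]
    · simp
  have hB := congrArg (rescale (-1 : R)) hA
  simp only [map_add, map_sub, map_mul, map_pow, map_one, hX, hC] at hB
  have hB0 : constantCoeff (rescale (-1 : R) A) = 1 := by
    rw [← coeff_zero_eq_constantCoeff_apply, coeff_rescale]
    simp [hA0]
  generalize rescale (-1 : R) A = B at hB hB0 ⊢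
  have hu : IsUnit (B * g + 1 - (1 - C a * X - C b * X ^ 2) * g) := by
    rw [isUnit_iff_constantCoeff]
    simp [hB0, hg0]
  have key : (B * g - 1) * (B * g + 1 - (1 - C a * X - C b * X ^ 2) * g) = 0 := by
    linear_combination g ^ 2 * hB + hg
  exact sub_eq_zero.mp ((hu.mul_left_eq_zero).mp key)
end

section
/- Let g ∈ ℚ[[X]] be an involutory power series, i.e., g has constant coefficient 1 and f := −X·g satisfies f(f(X)) = X and g·g(f(X)) = 1. Then the compositional inverse of the power series X·g(X) is X·g(−X); that is, substituting X·g(−X) into X·g(X) gives X, and substituting X·g(X) into X·g(−X) gives X. (This corresponds to the fact that the A-sequence of the Bell pseudo-involution (g(x), xg(x)) has generating function A(x) = 1/g(−x).) -/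
open PowerSeries

/-- If `g` is involutory (constant coefficient `1`, and `f := −X·g` satisfies `f(f(X)) = X`
and `g·g(f(X)) = 1`), then the compositional inverse of `X·g(X)` is `X·g(−X)`:
substituting either into the other yields `X`. -/
theorem stmt_8 (g : PowerSeries ℚ)
    (hg0 : constantCoeff g = 1)
    (hff : substSeries (-(X * g)) (-(X * g)) = X)
    (hgf : g * substSeries (-(X * g)) g = 1) :
    substSeries (X * rescale (-1) g) (X * g) = X ∧
      substSeries (X * g) (X * rescale (-1) g) = X := by
  have h1 : X * rescale (-1) g = rescale (-1) (-(X * g)) := by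
    ext n
    rcases n with _ | n
    · simp
    · simp [coeff_succ_X_mul, coeff_rescale, pow_succ]
  have h2 : X * g = -(-(X * g)) := by ring
  have key : ∀ n, ∑ k ∈ Finset.range (n + 1),
      coeff k (-(X * g)) * coeff n ((-(X * g)) ^ k) = coeff n (X : PowerSeries ℚ) := by
    intro n
    rw [← hff, substSeries, coeff_mk, ← substSeries, hff]
  rw [h1]
  generalize hF : -(X * g) = F at *
  rw [h2]
  constructor
  · ext n
    rw [substSeries, coeff_mk]
    have : ∀ k, coeff k (-F) * coeff n ((rescale (-1 : ℚ) F) ^ k)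
        = -(-1) ^ n * (coeff k F * coeff n (F ^ k)) := by
      intro k
      rw [← map_pow, coeff_rescale, map_neg]
      ring
    simp only [this]
    rw [← Finset.mul_sum, key, coeff_X]
    split_ifs with h <;> simp [h]
  · ext n
    rw [substSeries, coeff_mk, ← key n]
    refine Finset.sum_congr rfl fun k _ => ?_
    rw [coeff_rescale, neg_pow F k]
    have e : ((-1 : PowerSeries ℚ) ^ k) = C ((-1 : ℚ) ^ k) := by simp
    rw [e, coeff_C_mul]
    have e2 : ((-1 : ℚ) ^ k) * (-1) ^ k = 1 := by rw [← mul_pow]; simp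
    linear_combination (coeff k F * coeff n (F ^ k)) * e2
end

section
/- Let a, d ∈ ℚ and let g ∈ ℚ[[X]] be the unique power series with constant coefficient 1 satisfying (1 − aX)·g = 1 + dX³·g² (the fixed-point form of the continued fraction g = 1/(1 − ax − dx³/(1 − ax − dx³/(1 − ax − ⋯))), corresponding to the Bell pseudo-involution with B-sequence generating function B(x) = a + dx). Then for every n ∈ ℕ, the n-th coefficient of g is gₙ = Σ_{k=0}^{⌊n/3⌋} C(n−k, n−3k)·dᵏ·a^{n−3k}·Catalan(k), where C(·,·) denotes a binomial coefficient and Catalan(k) is the k-th Catalan number. -/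
open PowerSeries

/-- If `g` is the power series with constant coefficient `1` satisfying
`(1 − aX)·g = 1 + dX³·g²`, then
`gₙ = ∑_{k=0}^{⌊n/3⌋} C(n−k, n−3k)·dᵏ·a^{n−3k}·Catalan(k)`. -/
theorem stmt_10 (a d : ℚ) (g : PowerSeries ℚ)
    (hg0 : constantCoeff g = 1)
    (hg : (1 - C a * X) * g = 1 + C d * X ^ 3 * g ^ 2) :
    ∀ n : ℕ, coeff n g =
      ∑ k ∈ Finset.range (n / 3 + 1),
        (Nat.choose (n - k) (n - 3 * k) : ℚ) * d ^ k * a ^ (n - 3 * k) * (catalan k : ℚ) := by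
  intro n
  set u : PowerSeries ℚ := rescale a (mk 1) with hu
  have hu1 : u * (1 - C a * X) = 1 := by
    have h := congrArg (rescale a) (mk_one_mul_one_sub_eq_one ℚ)
    simpa [rescale_X] using h
  set t : PowerSeries ℚ := C d * X ^ 3 * u ^ 2 with ht
  have ht0 : constantCoeff t = 0 := by simp [ht]
  have hs : HasSubst t := HasSubst.of_constantCoeff_zero' ht0
  set c : PowerSeries ℚ := PowerSeries.map (Nat.castRingHom ℚ) catalanSeries with hc
  have hc1 : c ^ 2 * X + 1 = c := by
    have h := congrArg (PowerSeries.map (Nat.castRingHom ℚ)) catalanSeries_sq_mul_X_add_one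
    simpa using h
  set H : PowerSeries ℚ := c.subst t with hH
  have hH1 : H ^ 2 * t + 1 = H := by
    have h := congrArg (substAlgHom (R := ℚ) hs) hc1
    rw [map_add, map_mul, map_pow, map_one, coe_substAlgHom, subst_X hs] at h
    exact h
  have hgu : g = u * ((1 - C a * X) * g) := by rw [← mul_assoc, hu1, one_mul]
  have hG : (1 - C a * X) * g = H := by
    have h1 : (1 - C a * X) * g = 1 + t * ((1 - C a * X) * g) ^ 2 := by
      have : t * ((1 - C a * X) * g) ^ 2 = C d * X ^ 3 * (u * ((1 - C a * X) * g)) ^ 2 := by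
        rw [ht]; ring
      rw [this, ← hgu, hg]
    generalize (1 - C a * X) * g = G at h1
    have h2 : (G - H) * (1 - t * (G + H)) = 0 := by
      linear_combination h1 + hH1
    rcases mul_eq_zero.1 h2 with h | h
    · exact sub_eq_zero.1 h
    · have := congrArg constantCoeff h
      simp [ht0] at this
  rw [hG] at hgu
  have htk : ∀ k, t ^ k = X ^ (3 * k) * (C (d ^ k) * u ^ (2 * k)) := by
    intro k
    rw [ht, mul_pow, mul_pow, ← pow_mul, ← pow_mul, map_pow]; ring
  have hdvd : (X : PowerSeries ℚ) ^ (n + 1) ∣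
      H - ∑ k ∈ Finset.range (n / 3 + 1), C (catalan k : ℚ) * t ^ k := by
    rw [X_pow_dvd_iff]
    intro m hm
    rw [map_sub, hH, coeff_subst' hs, sub_eq_zero, map_sum,
      finsum_eq_sum_of_support_subset (s := Finset.range (n / 3 + 1))]
    · apply Finset.sum_congr rfl
      intro k _
      rw [coeff_C_mul, hc, coeff_map, catalanSeries_coeff, smul_eq_mul]; rfl
    · intro k hk
      by_contra hk'
      apply hk
      simp only [Finset.coe_range, Set.mem_Iio, not_lt] at hk'
      have : ¬ 3 * k ≤ m := by omega
      simp [htk, coeff_X_pow_mul', this]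
  obtain ⟨R, hR⟩ := hdvd
  have hHe : g = ∑ k ∈ Finset.range (n / 3 + 1), C (catalan k : ℚ) * (u * t ^ k)
      + X ^ (n + 1) * (u * R) := by
    rw [hgu, sub_eq_iff_eq_add.1 hR, mul_add, Finset.mul_sum, add_comm]
    congr 1
    · exact Finset.sum_congr rfl fun k _ => by ring
    · ring
  rw [hHe, map_add, coeff_X_pow_mul', if_neg (by omega), add_zero, map_sum]
  apply Finset.sum_congr rfl
  intro k hk
  have hk3 : 3 * k ≤ n := by
    have := Finset.mem_range.1 hk
    omega
  have e : u * t ^ k = X ^ (3 * k) * (C (d ^ k) * u ^ (2 * k + 1)) := by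
    rw [htk]; ring
  rw [e, coeff_C_mul, coeff_X_pow_mul', if_pos hk3, coeff_C_mul, hu, ← map_pow,
    mk_one_pow_eq_mk_choose_add, coeff_rescale, coeff_mk]
  have h3 : 2 * k + (n - 3 * k) = n - k := by omega
  have h4 : (n - k).choose (2 * k) = (n - k).choose (n - 3 * k) := by
    rw [← h3]; exact Nat.choose_symm_add
  rw [h3, h4]; ring
end

section
/- Let a, b ∈ ℚ and let g ∈ ℚ[[X]] be the unique power series with constant coefficient 1 satisfying bX²·g² + (1 − aX − bX²)·g = 1. Then for every n ∈ ℕ, the n-th coefficient of g is gₙ = Σ_{k=0}^{⌊n/2⌋} (−b)ᵏ·Catalan(k)·Σ_{i=0}^{n−2k} C(n−i, 2k)·C(n−2k−i, i)·bⁱ·a^{n−2k−2i}, where all terms with 2i > n − 2k vanish because then C(n−2k−i, i) = 0. -/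
open PowerSeries

lemma exists_subst_hom (w : PowerSeries ℚ) (hw : constantCoeff w = 0) :
    ∃ φ : PowerSeries ℚ →ₐ[ℚ] PowerSeries ℚ, φ X = w := by
  have h : HasSubst w := HasSubst.of_constantCoeff_zero' hw
  exact ⟨substAlgHom h, substAlgHom_X h⟩

lemma coeff_hom_aux (φ : PowerSeries ℚ →ₐ[ℚ] PowerSeries ℚ) (e : ℕ)
    (hw : X ^ e ∣ φ X) (h f : PowerSeries ℚ) (n M : ℕ) (hn : n < e * M) :
    coeff n (h * φ f) = ∑ j ∈ Finset.range M, coeff j f * coeff n (h * (φ X) ^ j) := by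
  have hf : f = X ^ M * (mk fun i ↦ coeff (i + M) f) +
      ∑ j ∈ Finset.range M, coeff j f • (X : PowerSeries ℚ) ^ j := by
    ext j
    rw [map_add, map_sum, coeff_X_pow_mul']
    simp only [coeff_mk, coeff_smul, coeff_X_pow, smul_eq_mul, mul_ite, mul_one, mul_zero,
      Finset.sum_ite_eq, Finset.mem_range]
    split_ifs with h1 h2 h2
    · omega
    · simp [Nat.sub_add_cancel h1]
    · simp
    · omega
  have h0 : coeff n (h * φ (X ^ M * (mk fun i ↦ coeff (i + M) f))) = 0 := by
    have hd : (X : PowerSeries ℚ) ^ (e * M) ∣ h * φ (X ^ M * (mk fun i ↦ coeff (i + M) f)) := by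
      rw [map_mul, map_pow, pow_mul]
      exact Dvd.dvd.mul_left (Dvd.dvd.mul_right (pow_dvd_pow_of_dvd hw M) _) _
    exact X_pow_dvd_iff.mp hd n hn
  conv_lhs => rw [hf]
  rw [map_add, mul_add, map_add, h0, zero_add, map_sum, Finset.mul_sum, map_sum]
  refine Finset.sum_congr rfl fun j _ => ?_
  rw [map_smul, map_pow, mul_smul_comm, coeff_smul, smul_eq_mul]

lemma coeff_lin_pow (a b : ℚ) (j i : ℕ) :
    coeff i ((C a + C b * X : PowerSeries ℚ) ^ j) = (j.choose i : ℚ) * b ^ i * a ^ (j - i) := by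
  rw [add_comm, add_pow, map_sum]
  have : ∀ m ∈ Finset.range (j + 1),
      coeff i ((C b * X : PowerSeries ℚ) ^ m * C a ^ (j - m) * (j.choose m : PowerSeries ℚ))
        = if i = m then (j.choose i : ℚ) * b ^ i * a ^ (j - i) else 0 := by
    intro m _
    have e : (C b * X : PowerSeries ℚ) ^ m * C a ^ (j - m) * (j.choose m : PowerSeries ℚ)
        = C ((j.choose m : ℚ) * b ^ m * a ^ (j - m)) * X ^ m := by
      simp only [map_mul, map_pow, map_natCast]
      ring
    rw [e, coeff_C_mul, coeff_X_pow]
    split_ifs with h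
    · rw [h, mul_one]
    · rw [mul_zero]
  rw [Finset.sum_congr rfl this, Finset.sum_ite_eq]
  split_ifs with h
  · rfl
  · rw [Nat.choose_eq_zero_of_lt (by simpa using h)]; simp

lemma coeff_D_pow (a b : ℚ) (D : PowerSeries ℚ) (hD : D * (1 - C a * X - C b * X ^ 2) = 1)
    (m N : ℕ) :
    coeff N (D ^ (m + 1)) = ∑ i ∈ Finset.range (N + 1),
      ((m + N - i).choose m : ℚ) * ((N - i).choose i : ℚ) * b ^ i * a ^ (N - 2 * i) := by
  obtain ⟨φ, hφ⟩ := exists_subst_hom (X * (C a + C b * X)) (by simp)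
  have hD' : D = φ (mk 1) := by
    have h1 : φ (mk 1) * (1 - C a * X - C b * X ^ 2) = 1 := by
      have := congrArg φ (mk_one_mul_one_sub_eq_one ℚ)
      rw [map_mul, map_sub, map_one, hφ] at this
      linear_combination this
    calc D = D * (φ (mk 1) * (1 - C a * X - C b * X ^ 2)) := by rw [h1, mul_one]
      _ = φ (mk 1) * (D * (1 - C a * X - C b * X ^ 2)) := by ring
      _ = _ := by rw [hD, mul_one]
  have h2 := coeff_hom_aux φ 1 (by rw [hφ, pow_one]; exact dvd_mul_right _ _) 1
    ((mk 1 : PowerSeries ℚ) ^ (m + 1)) N (N + 1) (by omega)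
  rw [one_mul, map_pow, ← hD'] at h2
  rw [h2, ← Finset.sum_range_reflect]
  refine Finset.sum_congr rfl fun i hi => ?_
  have hi : i ≤ N := by simpa [Nat.lt_succ_iff] using hi
  rw [mk_one_pow_eq_mk_choose_add, coeff_mk, one_mul, hφ, mul_pow, coeff_X_pow_mul',
    if_pos (by omega), coeff_lin_pow]
  have e1 : N + 1 - 1 - i = N - i := by omega
  have e2 : N - (N - i) = i := by omega
  have e3 : m + (N - i) = m + N - i := by omega
  have e4 : N - i - i = N - 2 * i := by omega
  rw [e1, e2, e3, e4]
  ring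

/-- If `g` is the power series with constant coefficient `1` satisfying
`bX²·g² + (1 − aX − bX²)·g = 1`, then
`gₙ = ∑_{k=0}^{⌊n/2⌋} (−b)ᵏ·Catalan(k)·∑_{i=0}^{n−2k} C(n−i,2k)·C(n−2k−i,i)·bⁱ·a^{n−2k−2i}`. -/
theorem stmt_12 (a b : ℚ) (g : PowerSeries ℚ)
    (hg0 : constantCoeff g = 1)
    (hg : C b * X ^ 2 * g ^ 2 + (1 - C a * X - C b * X ^ 2) * g = 1) :
    ∀ n : ℕ, coeff n g =
      ∑ k ∈ Finset.range (n / 2 + 1), (-b) ^ k * (catalan k : ℚ) *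
        ∑ i ∈ Finset.range (n - 2 * k + 1),
          (Nat.choose (n - i) (2 * k) : ℚ) * (Nat.choose (n - 2 * k - i) i : ℚ) *
            b ^ i * a ^ (n - 2 * k - 2 * i) := by
  obtain ⟨D, hD⟩ : ∃ D : PowerSeries ℚ, D * (1 - C a * X - C b * X ^ 2) = 1 :=
    ⟨_, PowerSeries.inv_mul_cancel _ (by simp)⟩
  obtain ⟨φ, hφ⟩ := exists_subst_hom (X ^ 2 * (C (-b) * D ^ 2)) (by simp)
  set c : PowerSeries ℚ := map (Nat.castRingHom ℚ) catalanSeries with hc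
  have hcat : c ^ 2 * X + 1 = c := by
    have := congrArg (map (Nat.castRingHom ℚ)) catalanSeries_sq_mul_X_add_one
    simpa using this
  have hcat' : (φ c) ^ 2 * (X ^ 2 * (C (-b) * D ^ 2)) + 1 = φ c := by
    have := congrArg φ hcat
    rwa [map_add, map_mul, map_pow, map_one, hφ] at this
  have hG : C b * X ^ 2 * (D * φ c) ^ 2 + (1 - C a * X - C b * X ^ 2) * (D * φ c) = 1 := by
    rw [map_neg] at hcat'
    linear_combination (φ c) * hD - hcat'
  have hgG : g = D * φ c := by
    have h1 : (g - D * φ c) * (C b * X ^ 2 * (g + D * φ c) + (1 - C a * X - C b * X ^ 2)) = 0 := by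
      linear_combination hg - hG
    rcases mul_eq_zero.mp h1 with h | h
    · exact sub_eq_zero.mp h
    · have := congrArg constantCoeff h
      simp at this
  intro n
  rw [hgG, coeff_hom_aux φ 2 (by rw [hφ]; exact dvd_mul_right _ _) D c n (n / 2 + 1) (by omega)]
  refine Finset.sum_congr rfl fun k hk => ?_
  have hk : 2 * k ≤ n := by
    have := Finset.mem_range.mp hk
    omega
  have e : D * (X ^ 2 * (C (-b) * D ^ 2)) ^ k
      = C ((-b) ^ k) * (X ^ (2 * k) * D ^ (2 * k + 1)) := by
    rw [map_pow, mul_pow, mul_pow, ← pow_mul, ← pow_mul]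
    ring
  rw [hφ, e, coeff_C_mul, coeff_X_pow_mul', if_pos hk, coeff_D_pow a b D hD]
  have e1 : 2 * k + (n - 2 * k) = n := by omega
  rw [e1]
  have e2 : coeff k c = (catalan k : ℚ) := by simp [hc]
  rw [e2]
  ring
end

section
/- Let R be a commutative ring and a ∈ R. There exists a unique formal power series Y ∈ R[[X]] with constant coefficient 0 satisfying Y² − aX·Y − Y = X³ − X. (This is the power-series branch through the origin of the elliptic curve y² − axy − y = x³ − x; its coefficients begin 0, 1, 1−a, 1−3a+a², ….) -/
open PowerSeries

/-- For a commutative ring `R` and `a : R`, there is a unique formal power series `Y`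
with constant coefficient `0` satisfying `Y² − aX·Y − Y = X³ − X` (the power-series branch
through the origin of the elliptic curve `y² − axy − y = x³ − x`). -/
theorem stmt_13 (R : Type*) [CommRing R] (a : R) :
    ∃! Y : PowerSeries R, constantCoeff Y = 0 ∧
      Y ^ 2 - C a * X * Y - Y = X ^ 3 - X := by
  have hI : HenselianRing (PowerSeries R) (Ideal.span {(X : PowerSeries R)}) := inferInstance
  have hX : ∀ Z : PowerSeries R, Z ∈ Ideal.span {(X : PowerSeries R)} ↔ constantCoeff Z = 0 := by
    intro Z
    rw [Ideal.mem_span_singleton, X_dvd_iff]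
  have key := hI.is_henselian
    (Polynomial.X ^ 2 - Polynomial.C (C a * X + 1) * Polynomial.X
      - Polynomial.C ((X : PowerSeries R) ^ 3 - X))
    (by nontriviality R; monicity!) 0
    (by rw [hX]; simp)
    (by
      apply IsUnit.map
      rw [PowerSeries.isUnit_iff_constantCoeff]
      rw [Polynomial.derivative_sub, Polynomial.derivative_C]
      simp)
  obtain ⟨Y, hY, hY0⟩ := key
  rw [sub_zero, hX] at hY0
  have hY' : Y ^ 2 - C a * X * Y - Y = X ^ 3 - X := by
    simp only [Polynomial.IsRoot.def, Polynomial.eval_sub, Polynomial.eval_pow, Polynomial.eval_mul,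
      Polynomial.eval_X, Polynomial.eval_C] at hY
    linear_combination hY
  refine ⟨Y, ⟨hY0, hY'⟩, ?_⟩
  rintro Z ⟨hZ0, hZ⟩
  have hu : IsUnit (Z + Y - C a * X - 1) := by
    rw [PowerSeries.isUnit_iff_constantCoeff]
    simp [hZ0, hY0]
  have h : (Z - Y) * (Z + Y - C a * X - 1) = 0 := by
    linear_combination hZ - hY'
  exact sub_eq_zero.mp (hu.mul_left_eq_zero.mp h)
end

section
/- Let a ∈ ℚ and let g ∈ ℚ[[X]] be the unique power series with constant coefficient 1 satisfying X²((1−a) − (1−3a+a²)X)·g² + (1 − (2−a)X − (1−a)X²)·g = 1. Set f := −X·g and A := (g(−X))⁻¹, where g(−X) is the rescaling of g by −1, and let B := (2−a + (1−3a+a²)X)·(1 + (1−a)X)⁻¹. Then: (i) f(f(X)) = X and g·g(f(X)) = 1, so (g(x), xg(x)) is a Bell pseudo-involution; and (ii) A = 1 + X·B(X²·A⁻¹), where B(X²·A⁻¹) denotes the substitution of the series X²·A⁻¹ (which has constant coefficient 0) into B. (This is the pseudo-involution associated to the elliptic curve y² − axy − y = x³ − x; its B-sequence has generating function B(x) = (2−a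 + (1−3a+a²)x)/(1 + (1−a)x).) -/
open PowerSeries

theorem subst_C_self (f : PowerSeries ℚ) (c : ℚ) : (C c : PowerSeries ℚ).subst f = C c :=
  subst_C c

/-- Let `g` be the power series with constant coefficient `1` satisfying
`X²((1−a) − (1−3a+a²)X)·g² + (1 − (2−a)X − (1−a)X²)·g = 1`, let `f := −X·g`,
`A := (g(−X))⁻¹` and `B := (2−a + (1−3a+a²)X)·(1 + (1−a)X)⁻¹`.  Then (i) `f(f(X)) = X` and
`g·g(f(X)) = 1`, so `(g(x), xg(x))` is a Bell pseudo-involution, and (ii)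
`A = 1 + X·B(X²·A⁻¹)`. -/
theorem stmt_15 (a : ℚ) (g : PowerSeries ℚ)
    (hg0 : constantCoeff g = 1)
    (hg : X ^ 2 * (C (1 - a) - C (1 - 3 * a + a ^ 2) * X) * g ^ 2 +
        (1 - C (2 - a) * X - C (1 - a) * X ^ 2) * g = 1) :
    (substSeries (-(X * g)) (-(X * g)) = X ∧ g * substSeries (-(X * g)) g = 1) ∧
      (rescale (-1) g)⁻¹ =
        1 + X * substSeries (X ^ 2 * ((rescale (-1) g)⁻¹)⁻¹)
          ((C (2 - a) + C (1 - 3 * a + a ^ 2) * X) * (1 + C (1 - a) * X)⁻¹) := by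
  generalize 1 - 3 * a + a ^ 2 = q₀ at *
  generalize 1 - a = p₀ at *
  generalize 2 - a = r₀ at *
  have hf0 : constantCoeff (-(X * g)) = 0 := by simp
  have hs : HasSubst (-(X * g)) := HasSubst.of_constantCoeff_zero' hf0
  have key : g * substSeries (-(X * g)) g = 1 := by
    rw [substSeries_eq_subst _ _ hf0]
    have h := congrArg (substAlgHom (R := ℚ) hs) hg
    simp only [map_add, map_sub, map_mul, map_pow, map_one, substAlgHom_X] at h
    simp only [coe_substAlgHom, subst_C_self] at h
    have hh0 : constantCoeff (g.subst (-(X * g))) = 1 := by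
      have h1 := congrArg constantCoeff h
      simpa using h1
    generalize g.subst (-(X * g)) = k at h hh0
    have hginv : g * g⁻¹ = 1 := PowerSeries.mul_inv_cancel g (by simp [hg0])
    have hi0 : constantCoeff g⁻¹ = 1 := by simp [hg0]
    generalize g⁻¹ = i at hginv hi0
    generalize C q₀ = q at *
    generalize C p₀ = p at *
    generalize C r₀ = r at *
    have e : (k - i) * (X ^ 2 * g ^ 2 * (p + q * X * g) * (k + i) +
        (1 + r * X * g - p * X ^ 2 * g ^ 2)) = 0 := by
      have hi : X ^ 2 * g ^ 2 * (p + q * X * g) * i ^ 2 +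
          (1 + r * X * g - p * X ^ 2 * g ^ 2) * i = 1 := by
        linear_combination (X ^ 2 * (p + q * X * g) * (g * i + 1) + r * X - p * X ^ 2 * g +
          (X ^ 2 * (p - q * X) * g + 1 - r * X - p * X ^ 2)) * hginv - i * hg
      linear_combination h - hi
    have hki : k - i = 0 := by
      rcases mul_eq_zero.mp e with h1 | h1
      · exact h1
      · have h2 := congrArg constantCoeff h1
        simp at h2
    rw [sub_eq_zero.mp hki, hginv]
  refine ⟨⟨?_, key⟩, ?_⟩
  · rw [substSeries_eq_subst _ _ hf0] at key ⊢
    have h : (-(X * g)).subst (-(X * g)) = -(-(X * g) * g.subst (-(X * g))) := by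
      rw [← coe_substAlgHom hs, map_neg, map_mul, substAlgHom_X]
    rw [h]
    linear_combination X * key
  · have hG := congrArg (rescale (-1 : ℚ)) hg
    have hX : rescale (-1 : ℚ) X = -X := by simp [rescale_X]
    have hC : ∀ c : ℚ, rescale (-1 : ℚ) (C c) = C c := by
      intro c; ext n; simp only [coeff_rescale, coeff_C]; split_ifs with h <;> simp [h]
    simp only [map_add, map_sub, map_mul, map_pow, map_one, hX, hC] at hG
    have hG0 : constantCoeff (rescale (-1 : ℚ) g) = 1 := by
      rw [← coeff_zero_eq_constantCoeff_apply, coeff_rescale]; simp [hg0]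
    generalize rescale (-1 : ℚ) g = G at hG hG0
    have hGi : G * G⁻¹ = 1 := PowerSeries.mul_inv_cancel G (by simp [hG0])
    have hGii : G⁻¹⁻¹ = G := by
      rw [PowerSeries.inv_eq_iff_mul_eq_one (by simp [hG0]), hGi]
    rw [hGii]
    have hu0 : constantCoeff (X ^ 2 * G) = 0 := by simp
    have hsu : HasSubst (X ^ 2 * G) := HasSubst.of_constantCoeff_zero' hu0
    rw [substSeries_eq_subst _ _ hu0]
    have hD : (1 + C p₀ * X : PowerSeries ℚ) * (1 + C p₀ * X)⁻¹ = 1 :=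
      PowerSeries.mul_inv_cancel _ (by simp)
    have hD' := congrArg (substAlgHom (R := ℚ) hsu) hD
    rw [← coe_substAlgHom hsu]
    simp only [map_add, map_mul, map_one, substAlgHom_X] at hD' ⊢
    simp only [coe_substAlgHom, subst_C_self] at hD' ⊢
    generalize (1 + C p₀ * X : PowerSeries ℚ)⁻¹.subst (X ^ 2 * G) = d at hD' ⊢
    generalize G⁻¹ = i at *
    generalize C q₀ = q at *
    generalize C p₀ = p at *
    generalize C r₀ = r at *
    linear_combination -(i - 1) * hD' + d * (-i * hG +
      (1 + p * (X ^ 2 * G) + X * (r + q * (X ^ 2 * G))) * hGi)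
end

section
/- Let R be a commutative ring and a ∈ R. The formal power series (2−a + (1−3a+a²)X)·(1 + (1−a)X)⁻¹ ∈ R[[X]] has coefficients b₀ = 2 − a and bₙ = −(a−1)^{n−1} for all n ≥ 1; that is, the B-sequence of the pseudo-involution associated with the elliptic curve y² − axy − y = x³ − x begins 2−a, −1, −(a−1), −(a−1)², −(a−1)³, …. -/
open PowerSeries

/-- Over a commutative ring `R`, the power series
`(2−a + (1−3a+a²)X)·(1 + (1−a)X)⁻¹` has coefficients `b₀ = 2 − a` and
`bₙ = −(a−1)^{n−1}` for `n ≥ 1`.  Here the inverse of `1 + (1−a)X`, whose constant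
coefficient is the unit `1`, is given by `PowerSeries.invOfUnit`. -/
theorem stmt_16 (R : Type*) [CommRing R] (a : R) :
    coeff 0 ((C (2 - a) + C (1 - 3 * a + a ^ 2) * X) *
        invOfUnit (1 + C (1 - a) * X) 1) = 2 - a ∧
      ∀ n : ℕ, 1 ≤ n →
        coeff n ((C (2 - a) + C (1 - 3 * a + a ^ 2) * X) *
          invOfUnit (1 + C (1 - a) * X) 1) = -(a - 1) ^ (n - 1) := by
  have h1 : (1 + C (1 - a) * X : PowerSeries R) * invOfUnit (1 + C (1 - a) * X) 1 = 1 :=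
    mul_invOfUnit _ _ (by simp)
  have h2 : (1 + C (1 - a) * X : PowerSeries R) * PowerSeries.mk (fun n => (a - 1) ^ n) = 1 := by
    ext n
    cases n with
    | zero => simp [add_mul, mul_assoc]
    | succ k =>
      rw [add_mul, one_mul, mul_assoc, map_add, coeff_C_mul, coeff_succ_X_mul, coeff_mk, coeff_mk,
        coeff_one, if_neg (Nat.succ_ne_zero k)]
      ring
  have h3 : invOfUnit (1 + C (1 - a) * X : PowerSeries R) 1
      = PowerSeries.mk (fun n => (a - 1) ^ n) := by
    calc _ = invOfUnit (1 + C (1 - a) * X : PowerSeries R) 1 *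
          ((1 + C (1 - a) * X : PowerSeries R) * PowerSeries.mk (fun n => (a - 1) ^ n)) := by
            rw [h2, mul_one]
      _ = ((1 + C (1 - a) * X : PowerSeries R) * invOfUnit (1 + C (1 - a) * X) 1) *
          PowerSeries.mk (fun n => (a - 1) ^ n) := by ring
      _ = _ := by rw [h1, one_mul]
  rw [h3]
  refine ⟨by simp [add_mul, mul_assoc], ?_⟩
  intro n hn
  obtain ⟨k, rfl⟩ : ∃ k, n = k + 1 := ⟨n - 1, by omega⟩
  rw [add_mul, mul_assoc, map_add, coeff_C_mul, coeff_C_mul, coeff_succ_X_mul, coeff_mk, coeff_mk,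
    Nat.add_sub_cancel]
  ring
end
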